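/- Let A be a separable RFD C*-algebra, let (e_n)_{n≥1} be the standard orthonormal basis of ℓ², and for each n ≥ 1 let P_n ∈ B(ℓ²) be the orthogonal projection onto span{e_1, …, e_n}. Then for every unital *-homomorphism ρ : A⁺ → B(ℓ²) there exists a sequence of *-homomorphisms τ_n : A⁺ → B(ℓ²) with τ_n(1) = P_n and τ_n(A⁺) ⊆ P_n B(ℓ²) P_n for every n, such that for every a ∈ A⁺ the sequence τ_n(a) converges to ρ(a) in the *-strong operator topology. -/

import Mathlib

/- STATEMENT 13: for a separable RFD C*-algebra `A`, every unital representation of `A⁺`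
on `ℓ²` is the *-SOT limit of a sequence of *-homomorphisms into the finite-dimensional
corners `P_n B(ℓ²) P_n`. -/

open Filter Topology

universe u

/-- The Hilbert space `ℓ²` of square-summable complex sequences. -/
noncomputable abbrev ell2 : Type := lp (fun _ : ℕ => ℂ) 2

/-- A sequence of operators converges in the *-strong operator topology to `T₀`. -/
def SOTStarTendsto {H : Type*} [NormedAddCommGroup H] [InnerProductSpace ℂ H]
    [CompleteSpace H] (T : ℕ → H →L[ℂ] H) (T₀ : H →L[ℂ] H) : Prop :=
  ∀ x : H, Tendsto (fun n => T n x) atTop (𝓝 (T₀ x)) ∧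
    Tendsto (fun n => star (T n) x) atTop (𝓝 (star T₀ x))

/-- A C*-algebra is residually finite-dimensional (RFD) if its representations on
finite-dimensional complex Hilbert spaces separate its points. -/
def IsRFD (A : Type u) [NonUnitalCStarAlgebra A] : Prop :=
  ∀ a : A, a ≠ 0 →
    ∃ (H : Type u) (_ : NormedAddCommGroup H) (_ : InnerProductSpace ℂ H)
      (_ : FiniteDimensional ℂ H) (π : A →⋆ₙₐ[ℂ] (H →L[ℂ] H)), π a ≠ 0

section MatrixForm

variable {B : Type*} [CStarAlgebra B] {H : Type*} [NormedAddCommGroup H] [InnerProductSpace ℂ H]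
  [CompleteSpace H] {k : Type*} [Fintype k]

/-- The sesquilinear form `∑ i j, ⟪x i, π (M i j) (x j)⟫` of a matrix over `B` in the
representation `π`. -/
noncomputable def matrixForm (π : B →⋆ₐ[ℂ] (H →L[ℂ] H)) (M : CStarMatrix k k B) (x : k → H) : ℂ :=
  ∑ i, ∑ j, inner ℂ (x i) (π (M i j) (x j))

lemma matrixForm_star (π : B →⋆ₐ[ℂ] (H →L[ℂ] H)) (M : CStarMatrix k k B) (x : k → H) :
    matrixForm π (star M) x = star (matrixForm π M x) := by
  simp only [matrixForm, star_sum]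
  rw [Finset.sum_comm]
  refine Finset.sum_congr rfl fun i _ => Finset.sum_congr rfl fun j _ => ?_
  rw [CStarMatrix.star_apply, map_star, ContinuousLinearMap.star_eq_adjoint,
    ContinuousLinearMap.adjoint_inner_right]
  simp

lemma matrixForm_add (π : B →⋆ₐ[ℂ] (H →L[ℂ] H)) (M N : CStarMatrix k k B) (x : k → H) :
    matrixForm π (M + N) x = matrixForm π M x + matrixForm π N x := by
  simp [matrixForm, Finset.sum_add_distrib]

lemma matrixForm_neg (π : B →⋆ₐ[ℂ] (H →L[ℂ] H)) (M : CStarMatrix k k B) (x : k → H) :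
    matrixForm π (-M) x = - matrixForm π M x := by
  simp [matrixForm]

lemma matrixForm_star_mul_mul (π : B →⋆ₐ[ℂ] (H →L[ℂ] H)) (D M : CStarMatrix k k B) (x : k → H) :
    matrixForm π (star D * M * D) x = matrixForm π M fun i => ∑ j, π (D i j) (x j) := by
  simp only [matrixForm, CStarMatrix.mul_apply, map_sum, map_mul, Finset.sum_mul,
    CStarMatrix.star_apply, map_star, sum_inner, inner_sum, sum_apply,
    mul_apply_eq_comp, ContinuousLinearMap.star_eq_adjoint,
    ContinuousLinearMap.adjoint_inner_right]
  calc _ = ∑ i, ∑ l, ∑ j, ∑ m,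
        inner ℂ (π (D l i) (x i)) (π (M l m) (π (D m j) (x j))) := by
        refine Finset.sum_congr rfl fun i _ => ?_
        exact (Finset.sum_congr rfl fun _ _ => Finset.sum_comm).trans Finset.sum_comm
    _ = _ := by
        rw [Finset.sum_comm]
        refine Finset.sum_congr rfl fun l _ => ?_
        rw [Finset.sum_comm]
        refine (Finset.sum_congr rfl fun j _ => Finset.sum_comm).trans Finset.sum_comm

lemma matrixForm_star_mul_self (π : B →⋆ₐ[ℂ] (H →L[ℂ] H)) (D : CStarMatrix k k B) (x : k → H) :
    matrixForm π (star D * D) x = ((∑ i, ‖∑ j, π (D i j) (x j)‖ ^ 2 : ℝ) : ℂ) := by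
  classical
  rw [← mul_one (star D), matrixForm_star_mul_mul, matrixForm, Complex.ofReal_sum]
  refine Finset.sum_congr rfl fun i _ => ?_
  rw [Finset.sum_eq_single i (fun j _ hj => by simp [hj.symm]) (by simp)]
  rw [CStarMatrix.one_apply_eq, map_one, one_apply_eq_self, inner_self_eq_norm_sq_to_K]
  simp

end MatrixForm

/-- A C⋆-algebra whose unital representations by complex matrices separate the points. -/
def MatrixSeparated (B : Type*) [CStarAlgebra B] : Prop :=
  ∀ b : B, b ≠ 0 → ∃ (m : ℕ) (σ : B →⋆ₐ[ℂ] Matrix (Fin m) (Fin m) ℂ), σ b ≠ 0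

section Positivity

variable {B : Type*} [CStarAlgebra B]

/-- The representation on Euclidean space given by a matrix representation. -/
noncomputable def euclideanRep {ι : Type*} [Fintype ι] [DecidableEq ι]
    (σ : B →⋆ₐ[ℂ] Matrix ι ι ℂ) :
    B →⋆ₐ[ℂ] (EuclideanSpace ℂ ι →L[ℂ] EuclideanSpace ℂ ι) :=
  ((Matrix.toEuclideanCLM (n := ι) (𝕜 := ℂ)) : _ →⋆ₐ[ℂ] _).comp σ

lemma euclideanRep_apply {ι : Type*} [Fintype ι] [DecidableEq ι]
    (σ : B →⋆ₐ[ℂ] Matrix ι ι ℂ) (b : B) :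
    euclideanRep σ b = Matrix.toEuclideanCLM (n := ι) (𝕜 := ℂ) (σ b) := rfl

lemma exists_star_mul_self_mul_self_eq_neg {C : Type*} [CStarAlgebra C] [PartialOrder C]
    [StarOrderedRing C] (h : C) (hsa : IsSelfAdjoint h) :
    ∃ d c : C, d = star c * c ∧ star d = d ∧ d * h = -(d * d) ∧
      (d = 0 → ∃ e : C, h = star e * e) := by
  have hd : 0 ≤ h⁻ := CFC.negPart_nonneg h
  obtain ⟨c, hc⟩ := CStarAlgebra.nonneg_iff_eq_star_mul_self.mp hd
  refine ⟨h⁻, c, hc, hd.isSelfAdjoint.star_eq, ?_, fun h0 => ?_⟩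
  · nth_rewrite 2 [← CFC.posPart_sub_negPart h hsa]
    rw [mul_sub, CFC.negPart_mul_posPart h, zero_sub]
  · exact CStarAlgebra.nonneg_iff_eq_star_mul_self.mp ((CFC.negPart_eq_zero_iff h hsa).mp h0)

lemma exists_star_mul_self_of_matrixForm_nonneg (hB : MatrixSeparated B) [PartialOrder B]
    [StarOrderedRing B] {k : Type*} [Fintype k] [DecidableEq k]
    {h : CStarMatrix k k B} (hsa : IsSelfAdjoint h)
    (hpos : ∀ (m : ℕ) (σ : B →⋆ₐ[ℂ] Matrix (Fin m) (Fin m) ℂ) (y : k → EuclideanSpace ℂ (Fin m)),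
      0 ≤ (matrixForm (euclideanRep σ) h y).re) : ∃ e : CStarMatrix k k B, h = star e * e := by
  obtain ⟨d, c, hc, hdsa, hdh, hd0⟩ := exists_star_mul_self_mul_self_eq_neg h hsa
  have hcube : star d * h * d = -(star (c * d) * (c * d)) := by
    rw [star_mul, mul_assoc (star d) (star c), ← mul_assoc (star c), ← hc, hdsa, hdh, neg_mul,
      mul_assoc]
  have hz : c * d = 0 := by
    ext i j
    by_contra hne
    obtain ⟨m, σ, hσ⟩ := hB _ hne
    apply hσ
    suffices h5 : euclideanRep σ ((c * d) i j) = 0 by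
      rwa [euclideanRep_apply, EmbeddingLike.map_eq_zero_iff] at h5
    refine ContinuousLinearMap.ext fun v => ?_
    have h3 := hpos m σ fun i => ∑ l, euclideanRep σ (d i l) (if l = j then v else 0)
    rw [← matrixForm_star_mul_mul, hcube, matrixForm_neg, matrixForm_star_mul_self,
      Complex.neg_re, Complex.ofReal_re, neg_nonneg] at h3
    have h4 := (Finset.sum_eq_zero_iff_of_nonneg (fun i _ => by positivity)).mp
      (le_antisymm h3 (Finset.sum_nonneg fun i _ => by positivity)) i (Finset.mem_univ i)
    rw [Finset.sum_eq_single j (fun l _ hl => by simp [hl]) (by simp)] at h4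
    simpa using h4
  refine hd0 ?_
  rw [← CStarRing.star_mul_self_eq_zero_iff, hdsa]
  nth_rewrite 1 [hc]
  rw [mul_assoc, hz, mul_zero]

lemma matrixForm_re_nonneg (hB : MatrixSeparated B) {k : Type*} [Fintype k] [DecidableEq k]
    (M : CStarMatrix k k B)
    (hpos : ∀ (m : ℕ) (σ : B →⋆ₐ[ℂ] Matrix (Fin m) (Fin m) ℂ) (y : k → EuclideanSpace ℂ (Fin m)),
      0 ≤ (matrixForm (euclideanRep σ) M y).re)
    {H : Type*} [NormedAddCommGroup H] [InnerProductSpace ℂ H] [CompleteSpace H]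
    (π : B →⋆ₐ[ℂ] (H →L[ℂ] H)) (x : k → H) : 0 ≤ (matrixForm π M x).re := by
  let _ := CStarAlgebra.spectralOrder B
  let _ := CStarAlgebra.spectralOrderedRing B
  obtain ⟨c, hc⟩ : ∃ c : CStarMatrix k k B, star M + M = star c * c := by
    refine exists_star_mul_self_of_matrixForm_nonneg hB (IsSelfAdjoint.star_add_self M)
      fun m σ y => ?_
    rw [matrixForm_add, matrixForm_star]
    simpa using hpos m σ y
  have h1 : 0 ≤ (matrixForm π (star M + M) x).re := by
    rw [hc, matrixForm_star_mul_self, Complex.ofReal_re]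
    positivity
  rw [matrixForm_add, matrixForm_star] at h1
  simpa using h1

end Positivity

section DirectSum

variable {B : Type*} [CStarAlgebra B] {ι κ : Type*} [Fintype ι] [Fintype κ]

/-- The vector of a direct sum of Euclidean spaces with the given components. -/
noncomputable def euclideanSum (x : EuclideanSpace ℂ ι) (y : EuclideanSpace ℂ κ) :
    EuclideanSpace ℂ (ι ⊕ κ) :=
  WithLp.toLp 2 (Sum.elim x y)

lemma inner_euclideanSum (x x' : EuclideanSpace ℂ ι) (y y' : EuclideanSpace ℂ κ) :
    inner ℂ (euclideanSum x y) (euclideanSum x' y') = inner ℂ x x' + inner ℂ y y' := by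
  simp [euclideanSum, PiLp.inner_apply]

variable [DecidableEq ι] [DecidableEq κ]

/-- The direct sum of two matrix representations. -/
noncomputable def directSumRep (σ : B →⋆ₐ[ℂ] Matrix ι ι ℂ) (τ : B →⋆ₐ[ℂ] Matrix κ κ ℂ) :
    B →⋆ₐ[ℂ] Matrix (ι ⊕ κ) (ι ⊕ κ) ℂ where
  toFun b := Matrix.fromBlocks (σ b) 0 0 (τ b)
  map_one' := by simp
  map_mul' a b := by simp [Matrix.fromBlocks_multiply]
  map_zero' := by simp
  map_add' a b := by simp [Matrix.fromBlocks_add]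
  commutes' r := by
    rw [AlgHomClass.commutes, AlgHomClass.commutes, Algebra.algebraMap_eq_smul_one,
      Algebra.algebraMap_eq_smul_one, Algebra.algebraMap_eq_smul_one, ← Matrix.fromBlocks_one,
      Matrix.fromBlocks_smul, smul_zero, smul_zero]
  map_star' a := by
    simp [map_star, Matrix.star_eq_conjTranspose, Matrix.fromBlocks_conjTranspose]

lemma euclideanRep_directSumRep (σ : B →⋆ₐ[ℂ] Matrix ι ι ℂ) (τ : B →⋆ₐ[ℂ] Matrix κ κ ℂ) (b : B)
    (x : EuclideanSpace ℂ ι) (y : EuclideanSpace ℂ κ) :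
    euclideanRep (directSumRep σ τ) b (euclideanSum x y) =
      euclideanSum (euclideanRep σ b x) (euclideanRep τ b y) := by
  apply WithLp.ofLp_injective
  simp only [euclideanRep_apply, euclideanSum, directSumRep, Matrix.ofLp_toEuclideanCLM]
  exact (Matrix.fromBlocks_mulVec _ _ _ _ _).trans (by simp)

/-- The multiple of a character acting on a matrix algebra by scalars. -/
noncomputable def scalarRep (ι : Type*) [Fintype ι] [DecidableEq ι] (χ : B →⋆ₐ[ℂ] ℂ) :
    B →⋆ₐ[ℂ] Matrix ι ι ℂ :=
  (StarAlgHom.ofId ℂ (Matrix ι ι ℂ)).comp χ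

lemma euclideanRep_scalarRep (χ : B →⋆ₐ[ℂ] ℂ) (b : B) (x : EuclideanSpace ℂ ι) :
    euclideanRep (scalarRep ι χ) b x = χ b • x := by
  have h : euclideanRep (scalarRep ι χ) b = χ b • 1 := by
    rw [euclideanRep_apply, ← Algebra.algebraMap_eq_smul_one]
    exact AlgHomClass.commutes (Matrix.toEuclideanCLM (n := ι) (𝕜 := ℂ)) (χ b)
  rw [h]
  simp

end DirectSum

section Coefficients

variable {B : Type*} [CStarAlgebra B] {p k : Type*}

/-- The tables of matrix coefficients `⟪y i, σ (t s) (y j)⟫` of finite-dimensional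
representations. -/
def coefficientTables (k : Type*) (t : p → B) : Set (p × k × k → ℂ) :=
  {w | ∃ (ι : Type) (_ : Fintype ι) (_ : DecidableEq ι) (σ : B →⋆ₐ[ℂ] Matrix ι ι ℂ)
    (y : k → EuclideanSpace ℂ ι),
      ∀ s, w s = inner ℂ (y s.2.1) (euclideanRep σ (t s.1) (y s.2.2))}

lemma smul_mem_coefficientTables {t : p → B} {w : p × k × k → ℂ} (hw : w ∈ coefficientTables k t)
    {c : ℝ} (hc : 0 ≤ c) : c • w ∈ coefficientTables k t := by
  obtain ⟨ι, _, _, σ, y, hy⟩ := hw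
  refine ⟨ι, _, _, σ, fun i => ((√c : ℝ) : ℂ) • y i, fun s => ?_⟩
  rw [Pi.smul_apply, hy, map_smul, inner_smul_left, inner_smul_right, ← mul_assoc,
    Complex.conj_ofReal, ← Complex.ofReal_mul, Real.mul_self_sqrt hc, Complex.real_smul]

lemma add_mem_coefficientTables {t : p → B} {w w' : p × k × k → ℂ}
    (hw : w ∈ coefficientTables k t) (hw' : w' ∈ coefficientTables k t) :
    w + w' ∈ coefficientTables k t := by
  obtain ⟨ι, _, _, σ, y, hy⟩ := hw
  obtain ⟨κ, _, _, τ, z, hz⟩ := hw'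
  refine ⟨ι ⊕ κ, inferInstance, inferInstance, directSumRep σ τ,
    fun i => euclideanSum (y i) (z i), fun s => ?_⟩
  rw [Pi.add_apply, hy, hz, euclideanRep_directSumRep, inner_euclideanSum]

lemma convex_coefficientTables (t : p → B) : Convex ℝ (coefficientTables k t) :=
  fun _ hw _ hw' _ _ ha hb _ =>
    add_mem_coefficientTables (smul_mem_coefficientTables hw ha) (smul_mem_coefficientTables hw' hb)

lemma matrixForm_sum_smul [Fintype p] [Fintype k] (t : p → B) {H : Type*} [NormedAddCommGroup H]
    [InnerProductSpace ℂ H] [CompleteSpace H] (π : B →⋆ₐ[ℂ] (H →L[ℂ] H)) (c : p × k × k → ℂ)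
    (x : k → H) :
    matrixForm π (CStarMatrix.ofMatrix fun i j => ∑ s, c (s, i, j) • t s) x =
      ∑ s : p × k × k, c s * inner ℂ (x s.2.1) (π (t s.1) (x s.2.2)) := by
  change ∑ i, ∑ j, inner ℂ (x i) (π (∑ s, c (s, i, j) • t s) (x j)) = _
  simp only [map_sum, map_smul, sum_apply, inner_sum, smul_apply, inner_smul_right,
    Fintype.sum_prod_type]
  exact (Finset.sum_congr rfl fun i _ => Finset.sum_comm).trans Finset.sum_comm

lemma coefficients_mem_closure [Fintype p] [Fintype k] (hB : MatrixSeparated B) (t : p → B)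
    {H : Type*} [NormedAddCommGroup H] [InnerProductSpace ℂ H] [CompleteSpace H]
    (π : B →⋆ₐ[ℂ] (H →L[ℂ] H)) (x : k → H) :
    (fun s : p × k × k => inner ℂ (x s.2.1) (π (t s.1) (x s.2.2))) ∈
      closure (coefficientTables k t) := by
  classical
  by_contra hx
  obtain ⟨f, u, hfx, hf⟩ := RCLike.geometric_hahn_banach_point_closed (𝕜 := ℂ)
    (convex_coefficientTables t).closure isClosed_closure hx
  have hmem : (0 : p × k × k → ℂ) ∈ coefficientTables k t :=
    ⟨Fin 0, inferInstance, inferInstance,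
      { toFun := fun _ => 0, map_one' := Subsingleton.elim _ _, map_mul' := by simp,
        map_zero' := rfl, map_add' := by simp, commutes' := fun _ => Subsingleton.elim _ _,
        map_star' := by simp }, 0, fun s => by simp⟩
  have hu : u < 0 := by simpa using hf 0 (subset_closure hmem)
  have hpos : ∀ w ∈ coefficientTables k t, 0 ≤ (f w).re := by
    intro w hw
    by_contra! hneg
    have h1 := hf _ (subset_closure (smul_mem_coefficientTables hw
      (c := u / (f w).re) (div_nonneg_of_nonpos hu.le hneg.le)))
    rw [show (u / (f w).re) • w = ((u / (f w).re : ℝ) : ℂ) • w from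
      (Complex.coe_smul _ _).symm, map_smul] at h1
    simp [div_mul_cancel₀ _ hneg.ne] at h1
  let M : CStarMatrix k k B :=
    CStarMatrix.ofMatrix fun i j => ∑ s, f (Pi.single (s, i, j) 1) • t s
  have hf_apply : ∀ w : p × k × k → ℂ, f w = ∑ s, f (Pi.single s 1) * w s := fun w => by
    conv_lhs => rw [pi_eq_sum_univ' w, map_sum]
    refine Finset.sum_congr rfl fun s _ => ?_
    rw [map_smul, smul_eq_mul, mul_comm]
  have h0 : 0 ≤ (matrixForm π M x).re := by
    refine matrixForm_re_nonneg hB M (fun m σ y => ?_) π x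
    rw [matrixForm_sum_smul t _ (fun s => f (Pi.single s 1)), ← hf_apply]
    exact hpos _ ⟨Fin m, inferInstance, inferInstance, σ, y, fun s => rfl⟩
  rw [matrixForm_sum_smul t _ (fun s => f (Pi.single s 1)), ← hf_apply] at h0
  exact absurd (hfx.trans hu) (not_lt.mpr h0)

end Coefficients

section Orthonormalization

variable {B : Type*} [CStarAlgebra B] {p k : Type*} [Fintype p] [Fintype k] [DecidableEq k]

open scoped ComplexOrder in
lemma posSemidef_one_sub_of_norm_le {G : Matrix k k ℂ} (hG : G.IsHermitian) {δ : ℝ} (hδ : 0 ≤ δ)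
    (h : ∀ i j, ‖G i j - (1 - δ : ℝ) * (1 : Matrix k k ℂ) i j‖ ≤ δ / (Fintype.card k + 1)) :
    (1 - G).PosSemidef := by
  set E : Matrix k k ℂ := G - ((1 - δ : ℝ) : ℂ) • 1 with hE
  have hherm : (1 - G).IsHermitian := Matrix.isHermitian_one.sub hG
  refine .of_dotProduct_mulVec_nonneg hherm fun x => ?_
  have hsplit : 1 - G = (δ : ℂ) • 1 - E := by
    rw [hE]; push_cast; module
  have hEx : ‖star x ⬝ᵥ (E.mulVec x)‖ ≤ δ * ∑ i, ‖x i‖ ^ 2 := by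
    have h1 : ‖star x ⬝ᵥ (E.mulVec x)‖ ≤
        ∑ i, ∑ j, ‖x i‖ * (δ / (Fintype.card k + 1) * ‖x j‖) := by
      simp only [dotProduct, Matrix.mulVec, Finset.mul_sum]
      refine (norm_sum_le _ _).trans (Finset.sum_le_sum fun i _ =>
        (norm_sum_le _ _).trans (Finset.sum_le_sum fun j _ => ?_))
      simp only [norm_mul, Pi.star_apply, norm_star]
      gcongr
      simpa [hE] using h i j
    refine h1.trans ?_
    have h2 : ∑ i, ∑ j, ‖x i‖ * (δ / (Fintype.card k + 1) * ‖x j‖) =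
        δ / (Fintype.card k + 1) * (∑ i, ‖x i‖) ^ 2 := by
      rw [sq, Finset.sum_mul_sum, Finset.mul_sum]
      refine Finset.sum_congr rfl fun i _ => ?_
      rw [Finset.mul_sum]
      exact Finset.sum_congr rfl fun j _ => by ring
    have h3 : (∑ i, ‖x i‖) ^ 2 ≤ Fintype.card k * ∑ i, ‖x i‖ ^ 2 :=
      sq_sum_le_card_mul_sum_sq
    have h4 : 0 ≤ ∑ i, ‖x i‖ ^ 2 := by positivity
    rw [h2]
    calc _ ≤ δ / (Fintype.card k + 1) * ((Fintype.card k + 1) * ∑ i, ‖x i‖ ^ 2) := by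
          gcongr
          linarith
      _ = _ := by field_simp
  have hxx : star x ⬝ᵥ x = ((∑ i, ‖x i‖ ^ 2 : ℝ) : ℂ) := by
    simp only [dotProduct, Pi.star_apply, Complex.ofReal_sum]
    refine Finset.sum_congr rfl fun i _ => ?_
    rw [RCLike.star_def, RCLike.conj_mul]
    simp
  have hself : IsSelfAdjoint (star x ⬝ᵥ ((1 - G).mulVec x)) := by
    rw [IsSelfAdjoint, ← Matrix.star_dotProduct_star, star_star, Matrix.star_mulVec, hherm.eq,
      ← Matrix.dotProduct_mulVec]
  have him := Complex.conj_eq_iff_im.mp hself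
  rw [Complex.nonneg_iff]
  refine ⟨?_, him.symm⟩
  rw [hsplit, Matrix.sub_mulVec, dotProduct_sub, Matrix.smul_mulVec, Matrix.one_mulVec,
    dotProduct_smul, hxx, Complex.sub_re, smul_eq_mul, Complex.re_ofReal_mul, Complex.ofReal_re]
  linarith [(Complex.abs_re_le_norm _).trans hEx, le_abs_self (star x ⬝ᵥ (E.mulVec x)).re]

open scoped ComplexOrder MatrixOrder Matrix.Norms.L2Operator in
lemma exists_inner_eq_of_posSemidef {K : Matrix k k ℂ} (hK : K.PosSemidef) :
    ∃ z : k → EuclideanSpace ℂ k, ∀ i j, inner ℂ (z i) (z j) = K i j := by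
  obtain ⟨C, hC⟩ := CStarAlgebra.nonneg_iff_eq_star_mul_self.mp hK.nonneg
  refine ⟨fun i => WithLp.toLp 2 fun l => C l i, fun i j => ?_⟩
  rw [hC, Matrix.mul_apply, PiLp.inner_apply]
  simp [mul_comm]

lemma exists_orthonormal_coefficients_approx (hB : MatrixSeparated B) (χ : B →⋆ₐ[ℂ] ℂ)
    {k : Type} [Fintype k] [DecidableEq k]
    {H : Type*} [NormedAddCommGroup H] [InnerProductSpace ℂ H] [CompleteSpace H]
    (π : B →⋆ₐ[ℂ] (H →L[ℂ] H)) {e : k → H} (he : Orthonormal ℂ e) (t : p → B) {ε : ℝ}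
    (hε : 0 < ε) :
    ∃ (ι : Type) (_ : Fintype ι) (_ : DecidableEq ι) (σ : B →⋆ₐ[ℂ] Matrix ι ι ℂ)
      (y : k → EuclideanSpace ℂ ι), Orthonormal ℂ y ∧
        ∀ s i j, ‖inner ℂ (y i) (euclideanRep σ (t s) (y j)) - inner ℂ (e i) (π (t s) (e j))‖
          < ε := by
  set c : p × k × k → ℂ := fun s => inner ℂ (e s.2.1) (π (t s.1) (e s.2.2)) with hc
  set R : ℝ := ∑ s, ‖χ (t s)‖ + ∑ s, ‖c s‖ with hR
  have hR0 : 0 ≤ R := by positivity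
  have hRχ : ∀ s, ‖χ (t s)‖ ≤ R := fun s =>
    (Finset.single_le_sum (f := fun s => ‖χ (t s)‖) (fun _ _ => norm_nonneg _)
      (Finset.mem_univ s)).trans (le_add_of_nonneg_right (by positivity))
  have hRc : ∀ s, ‖c s‖ ≤ R := fun s =>
    (Finset.single_le_sum (f := fun s => ‖c s‖) (fun _ _ => norm_nonneg _)
      (Finset.mem_univ s)).trans (le_add_of_nonneg_left (by positivity))
  obtain ⟨δ, hδ, hδ1, hδε⟩ : ∃ δ : ℝ, 0 < δ ∧ δ ≤ 1 ∧ δ * (1 + 3 * R) < ε := by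
    refine ⟨min 1 (ε / (2 * (1 + 3 * R))), by positivity, min_le_left _ _, ?_⟩
    calc _ ≤ ε / (2 * (1 + 3 * R)) * (1 + 3 * R) := by gcongr; exact min_le_right _ _
      _ = ε / 2 := by field_simp
      _ < ε := by linarith
  set δ' : ℝ := δ / (Fintype.card k + 1) with hδ'
  have hδ'0 : 0 < δ' := by positivity
  have hδ'δ : δ' ≤ δ := div_le_self hδ.le (by linarith [Nat.cast_nonneg (α := ℝ) (Fintype.card k)])
  obtain ⟨w, ⟨ι, _, _, σ, y, hw⟩, hdist⟩ := Metric.mem_closure_iff.mp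
    (coefficients_mem_closure hB (fun s : Option p => s.elim 1 t) π
      (fun i => ((√(1 - δ) : ℝ) : ℂ) • e i)) δ' hδ'0
  have happrox : ∀ s i j, ‖inner ℂ (y i) (euclideanRep σ (Option.elim s 1 t) (y j)) -
      (1 - δ : ℝ) * inner ℂ (e i) (π (Option.elim s 1 t) (e j))‖ < δ' := by
    intro s i j
    have := (dist_pi_lt_iff hδ'0).mp hdist (s, i, j)
    rw [hw, dist_comm, dist_eq_norm] at this
    simp only [map_smul, inner_smul_left, inner_smul_right] at this
    rwa [← mul_assoc, Complex.conj_ofReal, ← Complex.ofReal_mul,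
      Real.mul_self_sqrt (by linarith)] at this
  set G : Matrix k k ℂ := Matrix.of fun i j => inner ℂ (y i) (y j) with hG
  have hGherm : G.IsHermitian := by
    ext i j
    simp [hG]
  have hG1 : ∀ i j, ‖G i j - (1 - δ : ℝ) * (1 : Matrix k k ℂ) i j‖ < δ' := by
    intro i j
    have := happrox none i j
    rw [Option.elim_none, map_one, map_one, one_apply_eq_self, one_apply_eq_self,
      orthonormal_iff_ite.mp he] at this
    simpa [hG, Matrix.one_apply] using this
  obtain ⟨z, hz⟩ := exists_inner_eq_of_posSemidef
    (posSemidef_one_sub_of_norm_le hGherm hδ.le fun i j => (hG1 i j).le)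
  have hzn : ∀ i j, ‖inner ℂ (z i) (z j)‖ ≤ δ' + δ := by
    intro i j
    rw [hz]
    have h1 : (1 - G) i j = -(G i j - (1 - δ : ℝ) * (1 : Matrix k k ℂ) i j) +
        δ * (1 : Matrix k k ℂ) i j := by
      rw [Matrix.sub_apply]; push_cast; ring
    rw [h1]
    refine (norm_add_le _ _).trans (add_le_add ?_ ?_)
    · rw [norm_neg]; exact (hG1 i j).le
    · rw [norm_mul, Complex.norm_real, Real.norm_of_nonneg hδ.le]
      refine mul_le_of_le_one_right hδ.le ?_
      rw [Matrix.one_apply]; split_ifs <;> simp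
  refine ⟨ι ⊕ k, inferInstance, inferInstance, directSumRep σ (scalarRep k χ),
    fun i => euclideanSum (y i) (z i), ?_, fun s i j => ?_⟩
  · rw [orthonormal_iff_ite]
    intro i j
    rw [inner_euclideanSum, hz]
    simp [hG, Matrix.one_apply]
  · rw [euclideanRep_directSumRep, inner_euclideanSum, euclideanRep_scalarRep, inner_smul_right]
    have h1 := happrox (some s) i j
    rw [Option.elim_some] at h1
    have h2 := hRc (s, i, j)
    simp only [hc] at h2
    set a : ℂ := inner ℂ (y i) (euclideanRep σ (t s) (y j))
    set b : ℂ := inner ℂ (e i) (π (t s) (e j))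
    set d : ℂ := inner ℂ (z i) (z j) with hd
    have h3 : a + χ (t s) * d - b = (a - (1 - δ : ℝ) * b) + (χ (t s) * d - δ * b) := by
      push_cast; ring
    have h4 : ‖χ (t s) * d‖ ≤ R * (δ + δ) := by
      rw [norm_mul]
      gcongr
      · exact hRχ s
      · exact (hzn i j).trans (by linarith)
    have h5 : ‖(δ : ℂ) * b‖ ≤ δ * R := by
      rw [norm_mul, Complex.norm_real, Real.norm_of_nonneg hδ.le]
      gcongr
    rw [h3]
    calc _ ≤ ‖a - (1 - δ : ℝ) * b‖ + (‖χ (t s) * d‖ + ‖(δ : ℂ) * b‖) :=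
          (norm_add_le _ _).trans (by gcongr; exact norm_sub_le _ _)
      _ < ε := by linarith

end Orthonormalization

section FixedDimension

variable {B : Type*} [CStarAlgebra B] {p : Type*} {H : Type*} [NormedAddCommGroup H]
  [InnerProductSpace ℂ H] [CompleteSpace H]

lemma exists_rep_fin_approx [Fintype p] (hB : MatrixSeparated B) (χ : B →⋆ₐ[ℂ] ℂ)
    (π : B →⋆ₐ[ℂ] (H →L[ℂ] H)) {e : ℕ → H} (he : Orthonormal ℂ e) (N : ℕ) (t : p → B) {ε : ℝ}
    (hε : 0 < ε) :
    ∃ n₀ : ℕ, ∀ n ≥ n₀, ∃ σ : B →⋆ₐ[ℂ] (EuclideanSpace ℂ (Fin n) →L[ℂ] EuclideanSpace ℂ (Fin n)),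
      ∀ (s : p) (i j : Fin n), (i : ℕ) < N → (j : ℕ) < N →
        ‖σ (t s) (EuclideanSpace.single j 1) i - inner ℂ (e i) (π (t s) (e j))‖ < ε := by
  obtain ⟨ι, _, _, σ, y, hy, hσ⟩ := exists_orthonormal_coefficients_approx hB χ π
    (he.comp (fun i : Fin N => (i : ℕ)) Fin.val_injective) t hε
  refine ⟨Fintype.card ι, fun n hn => ?_⟩
  let σ' := directSumRep σ (scalarRep (Fin (n - Fintype.card ι)) χ)
  let v : Fin n → EuclideanSpace ℂ (ι ⊕ Fin (n - Fintype.card ι)) :=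
    fun i => if h : (i : ℕ) < N then euclideanSum (y ⟨i, h⟩) 0 else 0
  have hv : Orthonormal ℂ (Set.domRestrict {i : Fin n | (i : ℕ) < N} v) := by
    rw [orthonormal_iff_ite] at hy ⊢
    rintro ⟨i, hi⟩ ⟨j, hj⟩
    have hi' : (i : ℕ) < N := hi
    have hj' : (j : ℕ) < N := hj
    simp [v, hi', hj', inner_euclideanSum, hy, Fin.ext_iff, Set.domRestrict_apply]
  obtain ⟨b, hb⟩ := hv.exists_orthonormalBasis_extension_of_card_eq
    (by simp [Nat.add_sub_of_le hn])
  refine ⟨(b.repr.conjStarAlgEquiv : _ →⋆ₐ[ℂ]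
    (EuclideanSpace ℂ (Fin n) →L[ℂ] EuclideanSpace ℂ (Fin n))).comp
      (euclideanRep σ'), fun s i j hi hj => ?_⟩
  have h1 : ((b.repr.conjStarAlgEquiv : _ →⋆ₐ[ℂ]
    (EuclideanSpace ℂ (Fin n) →L[ℂ] EuclideanSpace ℂ (Fin n))).comp (euclideanRep σ')) (t s)
      (EuclideanSpace.single j 1) i = inner ℂ (b i) (euclideanRep σ' (t s) (b j)) := by
    rw [← b.repr_apply_apply, ← b.repr_symm_single]
    rfl
  rw [h1, hb i hi, hb j hj]
  simp only [v, hi, hj, dif_pos, σ', euclideanRep_directSumRep, inner_euclideanSum, inner_zero_left,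
    add_zero]
  exact hσ s ⟨i, hi⟩ ⟨j, hj⟩

/-- The possibly degenerate representation obtained from `σ` by including the underlying Hilbert
space in a larger one. -/
noncomputable def extendRep {K : Type*} [NormedAddCommGroup K] [InnerProductSpace ℂ K]
    [CompleteSpace K] (V : K →L[ℂ] H) (hV : V.adjoint ∘L V = 1) (σ : B →⋆ₐ[ℂ] (K →L[ℂ] K)) :
    B →⋆ₙₐ[ℂ] (H →L[ℂ] H) where
  toFun b := V ∘L σ b ∘L V.adjoint
  map_smul' c b := by ext; simp
  map_zero' := by ext; simp
  map_add' a b := by ext; simp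
  map_mul' a b := by
    ext x
    have h (z : K) : V.adjoint (V z) = z := congr($hV z)
    simp [mul_apply_eq_comp, h]
  map_star' b := by
    rw [map_star, ContinuousLinearMap.star_eq_adjoint, ContinuousLinearMap.star_eq_adjoint,
      ContinuousLinearMap.adjoint_comp, ContinuousLinearMap.adjoint_comp,
      ContinuousLinearMap.adjoint_adjoint, ContinuousLinearMap.comp_assoc]

end FixedDimension

section Ell2

/-- The standard orthonormal basis of `ℓ²`. -/
noncomputable def ell2Basis (i : ℕ) : ell2 := lp.single 2 i 1

lemma ell2Basis_apply (i m : ℕ) : (ell2Basis i : ℕ → ℂ) m = if m = i then 1 else 0 := by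
  rw [ell2Basis, lp.coeFn_single]
  simp [Pi.single_apply]

lemma inner_ell2Basis (i : ℕ) (x : ell2) : inner ℂ (ell2Basis i) x = x i := by
  rw [ell2Basis, lp.inner_single_left]
  simp

lemma orthonormal_ell2Basis : Orthonormal ℂ ell2Basis := by
  rw [orthonormal_iff_ite]
  intro i j
  rw [inner_ell2Basis, ell2Basis_apply]

lemma topologicalClosure_span_ell2Basis :
    (Submodule.span ℂ (Set.range ell2Basis)).topologicalClosure = ⊤ := by
  rw [Submodule.topologicalClosure_eq_top_iff, Submodule.eq_bot_iff]
  intro x hx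
  ext i
  rw [← inner_ell2Basis]
  simpa using hx _ (Submodule.subset_span ⟨i, rfl⟩)

/-- The inclusion of `ℂⁿ` in `ℓ²` as the first `n` coordinates. -/
noncomputable def ell2Inclusion (n : ℕ) : EuclideanSpace ℂ (Fin n) →L[ℂ] ell2 :=
  ∑ i : Fin n, (EuclideanSpace.proj i : EuclideanSpace ℂ (Fin n) →L[ℂ] ℂ).smulRight (ell2Basis i)

lemma ell2Inclusion_apply (n : ℕ) (y : EuclideanSpace ℂ (Fin n)) (m : ℕ) :
    (ell2Inclusion n y : ℕ → ℂ) m = if h : m < n then y ⟨m, h⟩ else 0 := by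
  have h1 : (ell2Inclusion n y : ℕ → ℂ) m = ∑ i : Fin n, y i * (if m = i then 1 else 0) := by
    rw [ell2Inclusion, sum_apply, lp.coeFn_sum, Finset.sum_apply]
    simp [ell2Basis_apply]
  rw [h1]
  split_ifs with h
  · rw [Finset.sum_eq_single ⟨m, h⟩]
    · simp
    · intro i _ hi
      rw [if_neg (fun h' => hi (Fin.ext h'.symm)), mul_zero]
    · simp
  · exact Finset.sum_eq_zero fun i _ => by rw [if_neg (by omega), mul_zero]

lemma ell2Inclusion_single {n : ℕ} (i : Fin n) :
    ell2Inclusion n (EuclideanSpace.single i 1) = ell2Basis i := by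
  ext m
  rw [ell2Inclusion_apply, ell2Basis_apply]
  simp [Fin.ext_iff]
  omega

lemma adjoint_ell2Inclusion_apply {n : ℕ} (x : ell2) (i : Fin n) :
    (ell2Inclusion n).adjoint x i = x i := by
  rw [← inner_ell2Basis, ← ell2Inclusion_single, ← ContinuousLinearMap.adjoint_inner_right,
    EuclideanSpace.inner_single_left]
  simp

lemma adjoint_ell2Inclusion_comp (n : ℕ) :
    (ell2Inclusion n).adjoint ∘L ell2Inclusion n = 1 := by
  ext x i
  simp [adjoint_ell2Inclusion_apply, ell2Inclusion_apply]

lemma adjoint_ell2Inclusion_ell2Basis {n : ℕ} (i : Fin n) :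
    (ell2Inclusion n).adjoint (ell2Basis i) = EuclideanSpace.single i 1 := by
  rw [← ell2Inclusion_single]
  exact congr($(adjoint_ell2Inclusion_comp n) (EuclideanSpace.single i 1))

variable {B : Type*} [CStarAlgebra B] {n : ℕ}
  (σ : B →⋆ₐ[ℂ] (EuclideanSpace ℂ (Fin n) →L[ℂ] EuclideanSpace ℂ (Fin n)))

lemma extendRep_ell2Inclusion_one_apply (x : ell2) (i : ℕ) :
    (extendRep (ell2Inclusion n) (adjoint_ell2Inclusion_comp n) σ 1 x : ℕ → ℂ) i =
      if i < n then (x : ℕ → ℂ) i else 0 := by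
  have h : extendRep (ell2Inclusion n) (adjoint_ell2Inclusion_comp n) σ 1 x =
      ell2Inclusion n (σ 1 ((ell2Inclusion n).adjoint x)) := rfl
  rw [h, map_one, one_apply_eq_self, ell2Inclusion_apply]
  split_ifs with hi
  · rw [adjoint_ell2Inclusion_apply]
  · rfl

lemma inner_extendRep_ell2Inclusion (b : B) (i j : Fin n) :
    inner ℂ (ell2Basis i)
      (extendRep (ell2Inclusion n) (adjoint_ell2Inclusion_comp n) σ b (ell2Basis j)) =
      σ b (EuclideanSpace.single j 1) i := by
  have h : extendRep (ell2Inclusion n) (adjoint_ell2Inclusion_comp n) σ b (ell2Basis j) =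
      ell2Inclusion n (σ b ((ell2Inclusion n).adjoint (ell2Basis j))) := rfl
  rw [h, adjoint_ell2Inclusion_ell2Basis, inner_ell2Basis, ell2Inclusion_apply, dif_pos i.2]

end Ell2

section Diagonal

lemma exists_diagonal_seq {α : ℕ → Type*} (Q : ∀ n, ℕ → α n → Prop) (h₀ : ∀ n, ∃ a, Q n 0 a)
    (h : ∀ k, ∃ n₀, ∀ n ≥ n₀, ∃ a, Q n k a) :
    ∃ (a : ∀ n, α n) (κ : ℕ → ℕ), Tendsto κ atTop atTop ∧ ∀ n, Q n (κ n) (a n) := by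
  classical
  let κ : ℕ → ℕ := fun n => Nat.findGreatest (fun k => ∃ a, Q n k a) n
  have hκ (n : ℕ) : ∃ a, Q n (κ n) a :=
    Nat.findGreatest_spec (P := fun k => ∃ a, Q n k a) (Nat.zero_le n) (h₀ n)
  choose a ha using hκ
  refine ⟨a, κ, tendsto_atTop.2 fun k => ?_, ha⟩
  obtain ⟨n₀, hn₀⟩ := h k
  filter_upwards [eventually_ge_atTop n₀, eventually_ge_atTop k] with n hn hk
  exact Nat.le_findGreatest hk (hn₀ n hn)

lemma exists_seq_rep_tendsto_coefficients {B : Type*} [CStarAlgebra B] (hB : MatrixSeparated B)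
    (χ : B →⋆ₐ[ℂ] ℂ) (ρ : B →⋆ₐ[ℂ] (ell2 →L[ℂ] ell2)) (b : ℕ → B) :
    ∃ σ : ∀ n, B →⋆ₐ[ℂ] (EuclideanSpace ℂ (Fin n) →L[ℂ] EuclideanSpace ℂ (Fin n)),
      ∀ l i j, Tendsto (fun n => inner ℂ (ell2Basis i)
        (extendRep (ell2Inclusion n) (adjoint_ell2Inclusion_comp n) (σ n) (b l) (ell2Basis j)))
        atTop (𝓝 (inner ℂ (ell2Basis i) (ρ (b l) (ell2Basis j)))) := by
  obtain ⟨σ, κ, hκ, hσ⟩ := exists_diagonal_seq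
    (α := fun n => B →⋆ₐ[ℂ] (EuclideanSpace ℂ (Fin n) →L[ℂ] EuclideanSpace ℂ (Fin n)))
    (fun n k σ => ∀ (s : Fin k) (i j : Fin n), (i : ℕ) < k → (j : ℕ) < k →
      ‖σ (b s) (EuclideanSpace.single j 1) i -
        inner ℂ (ell2Basis i) (ρ (b s) (ell2Basis j))‖ < 1 / ((k : ℝ) + 1))
    (fun n => ⟨euclideanRep (scalarRep (Fin n) χ), fun s => s.elim0⟩)
    (fun k => exists_rep_fin_approx hB χ ρ orthonormal_ell2Basis k (fun s : Fin k => b s)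
      Nat.one_div_pos_of_nat)
  refine ⟨σ, fun l i j => ?_⟩
  rw [tendsto_iff_norm_sub_tendsto_zero]
  refine squeeze_zero' (Eventually.of_forall fun n => norm_nonneg _) ?_
    (tendsto_one_div_add_atTop_nhds_zero_nat.comp hκ)
  filter_upwards [eventually_gt_atTop i, eventually_gt_atTop j, hκ.eventually_gt_atTop i,
    hκ.eventually_gt_atTop j, hκ.eventually_gt_atTop l] with n hi hj hi' hj' hl
  have h := hσ n ⟨l, hl⟩ ⟨i, hi⟩ ⟨j, hj⟩ hi' hj'
  rw [← inner_extendRep_ell2Inclusion] at h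
  exact h.le

end Diagonal

section Convergence

lemma tendsto_apply_of_ell2Basis {f : ℕ → ell2 →L[ℂ] ℂ} {f₀ : ell2 →L[ℂ] ℂ} {C : ℝ}
    (hC : ∀ n, ‖f n‖ ≤ C)
    (hf : ∀ i, Tendsto (fun n => f n (ell2Basis i)) atTop (𝓝 (f₀ (ell2Basis i)))) (x : ell2) :
    Tendsto (fun n => f n x) atTop (𝓝 (f₀ x)) := by
  have hlip : ∀ n, LipschitzWith C.toNNReal (f n) := fun n =>
    (f n).lipschitz.weaken (NNReal.le_toNNReal_of_coe_le (hC n))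
  have hclosed : IsClosed {x | Tendsto (fun n => f n x) atTop (𝓝 (f₀ x))} :=
    (LipschitzWith.uniformEquicontinuous _ _ hlip).equicontinuous.isClosed_setOfPred_tendsto
      f₀.continuous
  have hspan : (Submodule.span ℂ (Set.range ell2Basis) : Set ell2) ⊆
      {x | Tendsto (fun n => f n x) atTop (𝓝 (f₀ x))} := by
    intro x hx
    induction hx using Submodule.span_induction with
    | mem x hx => obtain ⟨i, rfl⟩ := hx; exact hf i
    | zero => simp
    | add x y _ _ hx hy => simpa using Tendsto.add hx hy
    | smul c x _ hx => simpa using Tendsto.const_mul c hx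
  refine closure_minimal hspan hclosed ?_
  rw [← Submodule.topologicalClosure_coe, topologicalClosure_span_ell2Basis]
  trivial

lemma tendsto_inner_of_ell2Basis {T : ℕ → ell2 →L[ℂ] ell2} {T₀ : ell2 →L[ℂ] ell2} {C : ℝ}
    (hC : ∀ n, ‖T n‖ ≤ C)
    (hT : ∀ i j, Tendsto (fun n => inner ℂ (ell2Basis i) (T n (ell2Basis j))) atTop
      (𝓝 (inner ℂ (ell2Basis i) (T₀ (ell2Basis j))))) (x y : ell2) :
    Tendsto (fun n => inner ℂ x (T n y)) atTop (𝓝 (inner ℂ x (T₀ y))) := by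
  have h1 (i : ℕ) : Tendsto (fun n => inner ℂ (ell2Basis i) (T n y)) atTop
      (𝓝 (inner ℂ (ell2Basis i) (T₀ y))) :=
    tendsto_apply_of_ell2Basis (f := fun n => innerSL ℂ (ell2Basis i) ∘L T n)
      (f₀ := innerSL ℂ (ell2Basis i) ∘L T₀) (C := ‖innerSL ℂ (ell2Basis i)‖ * C)
      (fun n => (ContinuousLinearMap.opNorm_comp_le _ _).trans (by gcongr; exact hC n)) (hT i) y
  have h2 := tendsto_apply_of_ell2Basis (f := fun n => innerSL ℂ (T n y))
      (f₀ := innerSL ℂ (T₀ y)) (C := C * ‖y‖)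
      (fun n => by
        rw [innerSL_apply_norm]
        exact (T n).le_of_opNorm_le (hC n) y)
      (fun i => by simpa [Function.comp_def] using
        (Complex.continuous_conj.tendsto _).comp (h1 i)) x
  simpa [Function.comp_def] using (Complex.continuous_conj.tendsto _).comp h2

variable {B : Type*} [CStarAlgebra B]

lemma tendsto_apply_of_tendsto_inner {H : Type*} [NormedAddCommGroup H] [InnerProductSpace ℂ H]
    [CompleteSpace H] {τ : ℕ → B →⋆ₙₐ[ℂ] (H →L[ℂ] H)} {ρ : B →⋆ₐ[ℂ] (H →L[ℂ] H)}
    (h : ∀ b x y, Tendsto (fun n => inner ℂ x (τ n b y)) atTop (𝓝 (inner ℂ x (ρ b y))))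
    (b : B) (x : H) : Tendsto (fun n => τ n b x) atTop (𝓝 (ρ b x)) := by
  have hτ (n : ℕ) : ‖τ n b x‖ ^ 2 = (inner ℂ x (τ n (star b * b) x)).re := by
    rw [map_mul, map_star, mul_apply_eq_comp, ContinuousLinearMap.star_eq_adjoint,
      ContinuousLinearMap.adjoint_inner_right]
    exact (inner_self_eq_norm_sq (𝕜 := ℂ) _).symm
  have hρ : ‖ρ b x‖ ^ 2 = (inner ℂ x (ρ (star b * b) x)).re := by
    rw [map_mul, map_star, mul_apply_eq_comp, ContinuousLinearMap.star_eq_adjoint,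
      ContinuousLinearMap.adjoint_inner_right]
    exact (inner_self_eq_norm_sq (𝕜 := ℂ) _).symm
  have hsq (n : ℕ) : ‖τ n b x - ρ b x‖ ^ 2 = (inner ℂ x (τ n (star b * b) x)).re -
      2 * (inner ℂ (ρ b x) (τ n b x)).re + ‖ρ b x‖ ^ 2 := by
    rw [norm_sub_rev, norm_sub_sq (𝕜 := ℂ), ← hτ]
    simp only [RCLike.re_to_complex]
    ring
  have h0 : Tendsto (fun n => ‖τ n b x - ρ b x‖ ^ 2) atTop (𝓝 0) := by
    simp_rw [hsq]
    have hself : (inner ℂ (ρ b x) (ρ b x)).re = ‖ρ b x‖ ^ 2 := inner_self_eq_norm_sq (𝕜 := ℂ) _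
    have h1 := (((Complex.continuous_re.tendsto _).comp (h (star b * b) x x)).sub
      (((Complex.continuous_re.tendsto _).comp (h b (ρ b x) x)).const_mul 2)).add_const
        (‖ρ b x‖ ^ 2)
    rw [← hρ, hself] at h1
    rw [show (0 : ℝ) = ‖ρ b x‖ ^ 2 - 2 * ‖ρ b x‖ ^ 2 + ‖ρ b x‖ ^ 2 by ring]
    exact h1
  rw [tendsto_iff_norm_sub_tendsto_zero]
  simpa using h0.sqrt

open scoped CStarAlgebra in
lemma tendsto_inner_of_denseRange {τ : ℕ → B →⋆ₙₐ[ℂ] (ell2 →L[ℂ] ell2)}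
    {ρ : B →⋆ₐ[ℂ] (ell2 →L[ℂ] ell2)} {b : ℕ → B} (hb : DenseRange b)
    (h : ∀ l i j, Tendsto (fun n => inner ℂ (ell2Basis i) (τ n (b l) (ell2Basis j))) atTop
      (𝓝 (inner ℂ (ell2Basis i) (ρ (b l) (ell2Basis j))))) (c : B) (x y : ell2) :
    Tendsto (fun n => inner ℂ x (τ n c y)) atTop (𝓝 (inner ℂ x (ρ c y))) := by
  refine tendsto_inner_of_ell2Basis (fun n => NonUnitalStarAlgHom.norm_apply_le (τ n) c)
    (fun i j => ?_) x y
  have hlip : ∀ n, LipschitzWith 1 fun c => (inner ℂ (ell2Basis i) (τ n c (ell2Basis j)) : ℂ) := by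
    intro n
    refine LipschitzWith.of_dist_le_mul fun c d => ?_
    rw [dist_eq_norm, dist_eq_norm, ← inner_sub_right, ← sub_apply, ← map_sub, NNReal.coe_one,
      one_mul]
    refine (norm_inner_le_norm _ _).trans ?_
    rw [orthonormal_ell2Basis.1, one_mul]
    refine ((τ n (c - d)).le_opNorm _).trans ?_
    rw [orthonormal_ell2Basis.1, mul_one]
    exact NonUnitalStarAlgHom.norm_apply_le (τ n) _
  have hclosed := (LipschitzWith.uniformEquicontinuous _ _
    hlip).equicontinuous.isClosed_setOfPred_tendsto (l := atTop)
      (f := fun c => (inner ℂ (ell2Basis i) (ρ c (ell2Basis j)) : ℂ))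
      (by fun_prop)
  exact closure_minimal (Set.range_subset_iff.2 fun l => h l i j) hclosed (hb c)

end Convergence

section Unitization

variable {A : Type u} [NonUnitalCStarAlgebra A]

lemma starLift_eq_algebraMap_add {C : Type*} [Semiring C] [Algebra ℂ C] [StarRing C]
    [StarModule ℂ C] (φ : A →⋆ₙₐ[ℂ] C) (b : Unitization ℂ A) :
    Unitization.starLift φ b = algebraMap ℂ C b.fst + φ b.snd := rfl

/-- The character of the unitization whose kernel is the original algebra. -/
noncomputable def unitizationCharacter : Unitization ℂ A →⋆ₐ[ℂ] ℂ :=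
  Unitization.starLift (0 : A →⋆ₙₐ[ℂ] ℂ)

lemma IsRFD.matrixSeparated_unitization (hA : IsRFD A) : MatrixSeparated (Unitization ℂ A) := by
  intro b hb
  by_cases hl : b.fst = 0
  · have ha : b.snd ≠ 0 := fun h => hb (Unitization.ext hl h)
    obtain ⟨H, _, _, _, π, hπ⟩ := hA b.snd ha
    let _ : CompleteSpace H := FiniteDimensional.complete ℂ H
    let c := (stdOrthonormalBasis ℂ H).repr.conjStarAlgEquiv
    let m : (EuclideanSpace ℂ (Fin (Module.finrank ℂ H)) →L[ℂ]
      EuclideanSpace ℂ (Fin (Module.finrank ℂ H))) ≃⋆ₐ[ℂ] _ :=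
      (Matrix.toEuclideanCLM (n := Fin (Module.finrank ℂ H)) (𝕜 := ℂ)).symm
    refine ⟨Module.finrank ℂ H, ((c.trans m : (H →L[ℂ] H) ≃⋆ₐ[ℂ] _) : (H →L[ℂ] H) →⋆ₐ[ℂ] _).comp
      (Unitization.starLift π), fun h => hπ ?_⟩
    have h1 : (c.trans m) (Unitization.starLift π b) = 0 := h
    rw [map_eq_zero_iff _ (EquivLike.injective (c.trans m))] at h1
    rwa [starLift_eq_algebraMap_add, hl, map_zero, zero_add] at h1
  · refine ⟨1, scalarRep (Fin 1) unitizationCharacter, fun h => hl ?_⟩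
    have h1 : algebraMap ℂ (Matrix (Fin 1) (Fin 1) ℂ) (unitizationCharacter b) = 0 := h
    rw [unitizationCharacter, starLift_eq_algebraMap_add] at h1
    simpa [Matrix.algebraMap_matrix_apply] using congr($h1 0 0)

lemma separableSpace_unitization [TopologicalSpace.SeparableSpace A] :
    TopologicalSpace.SeparableSpace (Unitization ℂ A) :=
  (Unitization.uniformEquivProd (𝕜 := ℂ) (A := A)).symm.surjective.denseRange.separableSpace
    (Unitization.uniformEquivProd (𝕜 := ℂ) (A := A)).symm.continuous

end Unitization

theorem stmt_13 (A : Type u) [NonUnitalCStarAlgebra A]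
    [TopologicalSpace.SeparableSpace A] (hRFD : IsRFD A)
    -- `P n` is the orthogonal projection of `ℓ²` onto the span of the first `n` vectors
    -- of the standard orthonormal basis:
    (P : ℕ → (ell2 →L[ℂ] ell2))
    (hP : ∀ (n : ℕ) (x : ell2) (i : ℕ),
      (P n x : ℕ → ℂ) i = if i < n then (x : ℕ → ℂ) i else 0)
    (ρ : Unitization ℂ A →⋆ₐ[ℂ] (ell2 →L[ℂ] ell2)) :
    ∃ τ : ℕ → (Unitization ℂ A →⋆ₙₐ[ℂ] (ell2 →L[ℂ] ell2)),
      (∀ n, τ n 1 = P n) ∧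
      (∀ (n : ℕ) (b : Unitization ℂ A), P n * τ n b * P n = τ n b) ∧
      (∀ b : Unitization ℂ A, SOTStarTendsto (fun n => τ n b) (ρ b)) := by
  have := separableSpace_unitization (A := A)
  obtain ⟨σ, hσ⟩ := exists_seq_rep_tendsto_coefficients hRFD.matrixSeparated_unitization
    unitizationCharacter ρ (TopologicalSpace.denseSeq (Unitization ℂ A))
  let τ (n : ℕ) := extendRep (ell2Inclusion n) (adjoint_ell2Inclusion_comp n) (σ n)
  have hτ (n : ℕ) : τ n 1 = P n := by
    ext x i
    rw [hP]
    exact extendRep_ell2Inclusion_one_apply (σ n) x i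
  have hlim := tendsto_apply_of_tendsto_inner (τ := τ)
    (tendsto_inner_of_denseRange (TopologicalSpace.denseRange_denseSeq _) hσ)
  refine ⟨τ, hτ, fun n b => ?_, fun b x => ⟨hlim b x, ?_⟩⟩
  · rw [← hτ, ← map_mul, ← map_mul, one_mul, mul_one]
  · simpa only [map_star] using hlim (star b) x
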